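/- Let m ≥ 1, E = EuclideanSpace ℝ (Fin m), let μ be a Borel measure on E, and let C > 0 and a > 0 be real numbers such that μ(closedBall(p,r)) ≤ ENNReal.ofReal(C · r^(a+2)) for every p ∈ E and every r > 0. Let S ⊆ E be a compact set with μH[a](S) = 0 (vanishing a-dimensional Hausdorff measure). Then for every ε > 0 there exists a C¹ function ζ : E → ℝ such that 0 ≤ ζ(x) ≤ 1 for all x, ζ = 1 on an open neighborhood of S, tsupport ζ ⊆ { x | infDist(x, S) < ε }, and ∫_E ‖Dζ(x)‖² dμ(x) < ε, where Dζ = fderiv ℝ ζ. -/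

import Mathlib

open MeasureTheory Metric Set Filter Topology
open scoped ENNReal

/-- The square of the positive part: a `C¹` function on the line, zero on `(-∞, 0]`. -/
noncomputable def sqPosPart (t : ℝ) : ℝ := (max 0 t) ^ 2

theorem sqPosPart_nonneg (t : ℝ) : 0 ≤ sqPosPart t := sq_nonneg _

theorem sqPosPart_of_nonpos {t : ℝ} (ht : t ≤ 0) : sqPosPart t = 0 := by
  simp [sqPosPart, max_eq_left ht]

theorem sqPosPart_le_one {t : ℝ} (ht : t ≤ 1) : sqPosPart t ≤ 1 :=
  pow_le_one₀ (le_max_left _ _) (max_le zero_le_one ht)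

theorem abs_sqPosPart_sub_sub_le (s t : ℝ) :
    |sqPosPart t - sqPosPart s - 2 * max 0 s * (t - s)| ≤ (t - s) ^ 2 := by
  unfold sqPosPart
  rw [abs_le]
  rcases le_total 0 s with hs | hs <;> rcases le_total 0 t with ht | ht <;>
    simp only [max_eq_left, max_eq_right, hs, ht] <;> constructor <;> nlinarith

theorem hasDerivAt_sqPosPart (s : ℝ) : HasDerivAt sqPosPart (2 * max 0 s) s := by
  have hrem : HasFDerivAt
      (fun t ↦ sqPosPart t - sqPosPart s - 2 * max 0 s * (t - s)) (0 : ℝ →L[ℝ] ℝ) s := by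
    refine Asymptotics.IsBigO.hasFDerivAt (n := 2) (Asymptotics.IsBigO.of_bound 1 ?_) one_lt_two
    filter_upwards with t
    simpa using abs_sqPosPart_sub_sub_le s t
  have hlin : HasDerivAt (fun t : ℝ ↦ sqPosPart s + 2 * max 0 s * (t - s)) (2 * max 0 s) s := by
    simpa using (((hasDerivAt_id s).sub_const s).const_mul (2 * max 0 s)).const_add (sqPosPart s)
  have h := hrem.hasDerivAt.add hlin
  simp only [zero_apply, zero_add] at h
  exact h.congr_of_eventuallyEq (Eventually.of_forall fun t ↦ by simp)

theorem contDiff_sqPosPart : ContDiff ℝ 1 sqPosPart := by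
  rw [contDiff_one_iff_deriv]
  refine ⟨fun s ↦ (hasDerivAt_sqPosPart s).differentiableAt, ?_⟩
  rw [show deriv sqPosPart = fun s ↦ 2 * max 0 s from
    funext fun s ↦ (hasDerivAt_sqPosPart s).deriv]
  fun_prop

section Bump

variable {E : Type*} [NormedAddCommGroup E] {F : Finset ℕ} {p : ℕ → E} {r : ℕ → ℝ}

/-- A `C¹` bump, at least `1` on the ball of radius `r` about `p` and zero outside the ball of
radius `2 * r`, whose squared gradient is controlled by the bump itself. -/
noncomputable def quadraticBump (p : E) (r : ℝ) (x : E) : ℝ :=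
  2 * sqPosPart (1 - ‖x - p‖ ^ 2 / (4 * r ^ 2))

theorem quadraticBump_nonneg (p : E) (r : ℝ) (x : E) : 0 ≤ quadraticBump p r x :=
  mul_nonneg zero_le_two (sqPosPart_nonneg _)

theorem one_le_quadraticBump {p x : E} {r : ℝ} (hr : 0 < r) (hx : x ∈ ball p r) :
    1 ≤ quadraticBump p r x := by
  rw [mem_ball, dist_eq_norm] at hx
  have h : ‖x - p‖ ^ 2 / (4 * r ^ 2) ≤ 1 / 4 := by
    rw [div_le_iff₀ (by positivity)]
    nlinarith [norm_nonneg (x - p)]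
  unfold quadraticBump sqPosPart
  rw [max_eq_right (by linarith)]
  nlinarith

theorem one_le_norm_sq_div {p x : E} {r : ℝ} (hr : 0 < r) (hx : x ∉ closedBall p (2 * r)) :
    1 ≤ ‖x - p‖ ^ 2 / (4 * r ^ 2) := by
  rw [mem_closedBall, dist_eq_norm, not_le] at hx
  rw [le_div_iff₀ (by positivity)]
  nlinarith

theorem quadraticBump_eq_zero {p x : E} {r : ℝ} (hr : 0 < r) (hx : x ∉ closedBall p (2 * r)) :
    quadraticBump p r x = 0 := by
  unfold quadraticBump
  rw [sqPosPart_of_nonpos (by linarith [one_le_norm_sq_div hr hx]), mul_zero]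

/-- The cutoff glued from finitely many bumps. -/
noncomputable def bumpCutoff (F : Finset ℕ) (p : ℕ → E) (r : ℕ → ℝ) (x : E) : ℝ :=
  1 - sqPosPart (1 - ∑ i ∈ F, quadraticBump (p i) (r i) x)

theorem bumpCutoff_le_one (x : E) : bumpCutoff F p r x ≤ 1 :=
  sub_le_self _ (sqPosPart_nonneg _)

theorem bumpCutoff_nonneg (x : E) : 0 ≤ bumpCutoff F p r x :=
  sub_nonneg.2 (sqPosPart_le_one
    (sub_le_self _ (Finset.sum_nonneg fun _ _ ↦ quadraticBump_nonneg _ _ _)))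

theorem bumpCutoff_eq_one (hr : ∀ i ∈ F, 0 < r i) {x : E}
    (hx : x ∈ ⋃ i ∈ F, ball (p i) (r i)) : bumpCutoff F p r x = 1 := by
  simp only [mem_iUnion] at hx
  obtain ⟨i, hi, hx⟩ := hx
  have h : quadraticBump (p i) (r i) x ≤ ∑ j ∈ F, quadraticBump (p j) (r j) x :=
    Finset.single_le_sum (f := fun j ↦ quadraticBump (p j) (r j) x)
      (fun _ _ ↦ quadraticBump_nonneg _ _ _) hi
  unfold bumpCutoff
  rw [sqPosPart_of_nonpos (by linarith [one_le_quadraticBump (hr i hi) hx]), sub_zero]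

theorem tsupport_bumpCutoff_subset (hr : ∀ i ∈ F, 0 < r i) :
    tsupport (bumpCutoff F p r) ⊆ ⋃ i ∈ F, closedBall (p i) (2 * r i) := by
  refine closure_minimal (fun x hx ↦ ?_)
    (F.finite_toSet.isClosed_biUnion fun i _ ↦ isClosed_closedBall)
  by_contra hne
  simp only [mem_iUnion, not_exists] at hne
  apply hx
  unfold bumpCutoff
  rw [Finset.sum_eq_zero fun i hi ↦ quadraticBump_eq_zero (hr i hi) (hne i hi)]
  simp [sqPosPart]

variable [InnerProductSpace ℝ E]

theorem contDiff_quadraticBump (p : E) (r : ℝ) : ContDiff ℝ 1 (quadraticBump p r) := by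
  unfold quadraticBump
  refine contDiff_const.mul (contDiff_sqPosPart.comp ?_)
  exact contDiff_const.sub (((contDiff_id.sub contDiff_const).norm_sq ℝ).div_const _)

theorem hasFDerivAt_quadraticBump (p : E) (r : ℝ) (x : E) :
    HasFDerivAt (quadraticBump p r)
      ((-(2 * max 0 (1 - ‖x - p‖ ^ 2 / (4 * r ^ 2)) / r ^ 2)) • innerSL ℝ (x - p)) x := by
  have h₁ : HasFDerivAt (fun y : E ↦ ‖y - p‖ ^ 2) (2 • innerSL ℝ (x - p)) x := by
    simpa using ((hasFDerivAt_id x).sub_const p).norm_sq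
  have h₂ := (h₁.mul_const (4 * r ^ 2)⁻¹).const_sub 1
  have h₃ := ((hasDerivAt_sqPosPart (1 - ‖x - p‖ ^ 2 * (4 * r ^ 2)⁻¹)).comp_hasFDerivAt x
    h₂).const_mul 2
  simp only [← div_eq_mul_inv] at h₃
  refine h₃.congr_fderiv ?_
  ext v
  simp
  ring

theorem norm_fderiv_quadraticBump_sq_le {p : E} {r : ℝ} (hr : 0 < r) (x : E) :
    ‖fderiv ℝ (quadraticBump p r) x‖ ^ 2 ≤
      quadraticBump p r x * (closedBall p (2 * r)).indicator (fun _ ↦ 8 / r ^ 2) x := by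
  rw [(hasFDerivAt_quadraticBump p r x).fderiv, norm_smul, innerSL_apply_norm, mul_pow]
  by_cases hx : x ∈ closedBall p (2 * r)
  · rw [indicator_of_mem hx]
    rw [mem_closedBall, dist_eq_norm] at hx
    have hx' : ‖x - p‖ ^ 2 ≤ 4 * r ^ 2 := by nlinarith [norm_nonneg (x - p)]
    unfold quadraticBump sqPosPart
    generalize max 0 (1 - ‖x - p‖ ^ 2 / (4 * r ^ 2)) = M
    rw [Real.norm_eq_abs, sq_abs]
    calc (-(2 * M / r ^ 2)) ^ 2 * ‖x - p‖ ^ 2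
        ≤ (-(2 * M / r ^ 2)) ^ 2 * (4 * r ^ 2) := by gcongr
      _ = 2 * M ^ 2 * (8 / r ^ 2) := by field_simp; ring
  · rw [indicator_of_notMem hx, max_eq_left (by linarith [one_le_norm_sq_div hr hx])]
    simp

theorem contDiff_bumpCutoff : ContDiff ℝ 1 (bumpCutoff F p r) :=
  contDiff_const.sub (contDiff_sqPosPart.comp
    (contDiff_const.sub (ContDiff.sum fun i _ ↦ contDiff_quadraticBump (p i) (r i))))

theorem norm_fderiv_bumpCutoff_sq_le (hr : ∀ i ∈ F, 0 < r i) (x : E) :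
    ‖fderiv ℝ (bumpCutoff F p r) x‖ ^ 2 ≤
      4 * ∑ i ∈ F, (closedBall (p i) (2 * r i)).indicator (fun _ ↦ 8 / r i ^ 2) x := by
  set Φ : ℝ := ∑ i ∈ F, quadraticBump (p i) (r i) x with hΦ
  set G : ℝ := ∑ i ∈ F, (closedBall (p i) (2 * r i)).indicator (fun _ ↦ 8 / r i ^ 2) x
  set L : E →L[ℝ] ℝ := ∑ i ∈ F, fderiv ℝ (quadraticBump (p i) (r i)) x
  have hind : ∀ i ∈ F, 0 ≤ (closedBall (p i) (2 * r i)).indicator (fun _ ↦ 8 / r i ^ 2) x :=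
    fun i _ ↦ indicator_nonneg (fun _ _ ↦ by positivity) _
  have hΦ0 : 0 ≤ Φ := Finset.sum_nonneg fun _ _ ↦ quadraticBump_nonneg _ _ _
  have hG0 : 0 ≤ G := Finset.sum_nonneg hind
  have hderiv : HasFDerivAt (bumpCutoff F p r) ((2 * max 0 (1 - Φ)) • L) x := by
    have h := ((hasDerivAt_sqPosPart (1 - Φ)).comp_hasFDerivAt x
      ((HasFDerivAt.fun_sum fun i (_ : i ∈ F) ↦ ((contDiff_quadraticBump (p i) (r i)).differentiable
        one_ne_zero x).hasFDerivAt).const_sub 1)).const_sub 1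
    refine h.congr_fderiv ?_
    rw [smul_neg, neg_neg]
  have hL : ‖L‖ ^ 2 ≤ Φ * G := by
    calc ‖L‖ ^ 2 ≤ (∑ i ∈ F, ‖fderiv ℝ (quadraticBump (p i) (r i)) x‖) ^ 2 := by
          gcongr; exact norm_sum_le _ _
      _ ≤ Φ * G := Finset.sum_sq_le_sum_mul_sum_of_sq_le_mul F
          (fun _ _ ↦ quadraticBump_nonneg _ _ _) hind
          fun i hi ↦ norm_fderiv_quadraticBump_sq_le (hr i hi) x
  rw [hderiv.fderiv, norm_smul, mul_pow, Real.norm_eq_abs, sq_abs]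
  rcases le_total Φ 1 with h | h
  · rw [max_eq_right (by linarith)]
    calc (2 * (1 - Φ)) ^ 2 * ‖L‖ ^ 2 ≤ 2 ^ 2 * (1 * G) := by
          gcongr
          · nlinarith
          · exact hL.trans (by gcongr)
      _ = 4 * G := by ring
  · rw [max_eq_left (by linarith)]
    simpa using hG0

theorem integral_norm_fderiv_bumpCutoff_sq_le [MeasurableSpace E] [BorelSpace E]
    {μ : Measure E} {C a : ℝ} (hC : 0 ≤ C)
    (hgrowth : ∀ (p : E) (r : ℝ), 0 < r →
      μ (closedBall p r) ≤ ENNReal.ofReal (C * r ^ (a + 2)))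
    (hr : ∀ i ∈ F, 0 < r i) :
    ∫ x, ‖fderiv ℝ (bumpCutoff F p r) x‖ ^ 2 ∂μ ≤
      32 * C * 2 ^ (a + 2) * ∑ i ∈ F, r i ^ a := by
  have hint : ∀ i ∈ F, Integrable
      ((closedBall (p i) (2 * r i)).indicator fun _ ↦ 8 / r i ^ 2) μ := fun i hi ↦
    (integrable_indicator_iff measurableSet_closedBall).2 (integrableOn_const
      ((hgrowth (p i) (2 * r i) (mul_pos two_pos (hr i hi))).trans_lt ENNReal.ofReal_lt_top).ne)
  calc ∫ x, ‖fderiv ℝ (bumpCutoff F p r) x‖ ^ 2 ∂μ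
      ≤ ∫ x, 4 * ∑ i ∈ F, (closedBall (p i) (2 * r i)).indicator (fun _ ↦ 8 / r i ^ 2) x ∂μ :=
        integral_mono_of_nonneg (Eventually.of_forall fun _ ↦ sq_nonneg _)
          ((integrable_finsetSum F hint).const_mul 4)
          (Eventually.of_forall (norm_fderiv_bumpCutoff_sq_le hr))
    _ = 4 * ∑ i ∈ F, μ.real (closedBall (p i) (2 * r i)) * (8 / r i ^ 2) := by
        rw [integral_const_mul, integral_finsetSum F hint]
        simp [integral_indicator_const, measurableSet_closedBall]
    _ ≤ 4 * ∑ i ∈ F, 8 * C * 2 ^ (a + 2) * r i ^ a := by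
        refine mul_le_mul_of_nonneg_left (Finset.sum_le_sum fun i hi ↦ ?_) zero_le_four
        have hri := hr i hi
        have hμ : μ.real (closedBall (p i) (2 * r i)) ≤ C * (2 * r i) ^ (a + 2) :=
          ENNReal.toReal_le_of_le_ofReal (by positivity)
            (hgrowth (p i) (2 * r i) (mul_pos two_pos hri))
        calc μ.real (closedBall (p i) (2 * r i)) * (8 / r i ^ 2)
            ≤ C * (2 * r i) ^ (a + 2) * (8 / r i ^ 2) := by gcongr
          _ = 8 * C * 2 ^ (a + 2) * r i ^ a := by
            rw [Real.mul_rpow zero_le_two hri.le, Real.rpow_add hri, Real.rpow_two]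
            field_simp
    _ = 32 * C * 2 ^ (a + 2) * ∑ i ∈ F, r i ^ a := by
        rw [← Finset.mul_sum]; ring

end Bump

/-- A compact set of vanishing `a`-dimensional Hausdorff measure is covered by finitely many
small balls centred on it with `∑ rᵢ ^ a` arbitrarily small. -/
theorem IsCompact.exists_finset_ball_cover_sum_rpow_lt {X : Type*} [MetricSpace X]
    [Nonempty X] [MeasurableSpace X] [BorelSpace X] {S : Set X} (hS : IsCompact S) {a : ℝ} (ha : 0 < a)
    (hnull : μH[a] S = 0) {δ η : ℝ} (hδ : 0 < δ) (hη : 0 < η) :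
    ∃ (F : Finset ℕ) (p : ℕ → X) (r : ℕ → ℝ), (∀ i ∈ F, p i ∈ S ∧ 0 < r i ∧ r i < δ) ∧
      S ⊆ ⋃ i ∈ F, ball (p i) (r i) ∧ ∑ i ∈ F, r i ^ a < η := by
  obtain ⟨t, htS, htd, hsum⟩ : ∃ t : ℕ → Set X, S ⊆ ⋃ n, t n ∧
      (∀ n, ediam (t n) ≤ ENNReal.ofReal (δ / 2)) ∧
      ∑' n, ⨆ _ : (t n).Nonempty, ediam (t n) ^ a < ENNReal.ofReal (η / 2) := by
    rw [Measure.hausdorffMeasure_apply] at hnull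
    have h := (ENNReal.iSup_eq_zero.1 (ENNReal.iSup_eq_zero.1 hnull (ENNReal.ofReal (δ / 2))))
      (by simpa using hδ)
    have h' := h.trans_lt (show 0 < ENNReal.ofReal (η / 2) by simpa using hη)
    simp only [iInf_lt_iff] at h'
    obtain ⟨t, h₁, h₂, h₃⟩ := h'
    exact ⟨t, h₁, h₂, h₃⟩
  have hdiam : ∀ n, ediam (t n) = ENNReal.ofReal (diam (t n)) := fun n ↦
    (ENNReal.ofReal_toReal ((htd n).trans_lt ENNReal.ofReal_lt_top).ne).symm
  have hrad : ∀ n, ∃ r, diam (t n) < r ∧ r < δ ∧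
      r ^ a < diam (t n) ^ a + η / 2 / 2 / 2 ^ n := fun n ↦ by
    have hlt : diam (t n) < δ := by
      have h := htd n
      rw [hdiam, ENNReal.ofReal_le_ofReal_iff (by positivity)] at h
      linarith
    have hcont : ∀ᶠ r in 𝓝[>] diam (t n), r ^ a < diam (t n) ^ a + η / 2 / 2 / 2 ^ n :=
      ((Real.continuous_rpow_const ha.le).continuousAt.eventually_lt continuousAt_const
        (lt_add_of_pos_right _ (by positivity))).filter_mono nhdsWithin_le_nhds
    obtain ⟨r, h₁, h₂, h₃⟩ := (eventually_mem_nhdsWithin.and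
      ((eventually_nhdsWithin_of_eventually_nhds (eventually_lt_nhds hlt)).and hcont)).exists
    exact ⟨r, h₁, h₂, h₃⟩
  choose r hdr hrδ hra using hrad
  have hpt : ∀ n, ∃ x, (t n ∩ S).Nonempty → x ∈ t n ∩ S := fun n ↦ by
    by_cases h : (t n ∩ S).Nonempty
    · exact h.imp fun x hx _ ↦ hx
    · exact ⟨Classical.arbitrary X, fun h' ↦ absurd h' h⟩
  choose p hp using hpt
  have hcover : S ⊆ ⋃ n ∈ {n | (t n ∩ S).Nonempty}, ball (p n) (r n) := fun x hx ↦ by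
    obtain ⟨n, hn⟩ := mem_iUnion.1 (htS hx)
    have hne : (t n ∩ S).Nonempty := ⟨x, hn, hx⟩
    refine mem_biUnion hne (mem_ball.2 (lt_of_le_of_lt ?_ (hdr n)))
    exact dist_le_diam_of_mem' ((htd n).trans_lt ENNReal.ofReal_lt_top).ne hn (hp n hne).1
  obtain ⟨b, hb, hbfin, hSb⟩ := hS.elim_finite_subcover_image (fun n _ ↦ isOpen_ball) hcover
  lift b to Finset ℕ using hbfin
  refine ⟨b, p, r, fun i hi ↦ ⟨(hp i (hb hi)).2, diam_nonneg.trans_lt (hdr i), hrδ i⟩, hSb, ?_⟩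
  have hdsum : ∑ i ∈ b, diam (t i) ^ a < η / 2 := by
    rw [← ENNReal.ofReal_lt_ofReal_iff (by positivity),
      ENNReal.ofReal_sum_of_nonneg fun i _ ↦ Real.rpow_nonneg diam_nonneg a]
    refine lt_of_le_of_lt (le_trans (Finset.sum_le_sum fun i hi ↦ ?_)
      (ENNReal.sum_le_tsum b)) hsum
    rw [← ENNReal.ofReal_rpow_of_nonneg diam_nonneg ha.le, ← hdiam]
    exact le_iSup (fun _ : (t i).Nonempty ↦ ediam (t i) ^ a) ((hb hi).mono inter_subset_left)
  have hesum : ∑ i ∈ b, η / 2 / 2 / 2 ^ i ≤ η / 2 :=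
    ((summable_geometric_two' (η / 2)).sum_le_tsum b fun _ _ ↦ by positivity).trans_eq
      (tsum_geometric_two' (η / 2))
  calc ∑ i ∈ b, r i ^ a ≤ ∑ i ∈ b, (diam (t i) ^ a + η / 2 / 2 / 2 ^ i) :=
        Finset.sum_le_sum fun i _ ↦ (hra i).le
    _ < η := by rw [Finset.sum_add_distrib]; linarith


open scoped MeasureTheory

/-- Weighted capacity estimate: if a Borel measure `μ` on Euclidean space
satisfies the growth bound `μ(B̄(p,r)) ≤ C r^{a+2}` and `S` is compact with
vanishing `a`-dimensional Hausdorff measure, then for every `ε > 0` there is a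
`C¹` cutoff `ζ` with `0 ≤ ζ ≤ 1`, `ζ = 1` near `S`, support in the
`ε`-neighborhood of `S`, and weighted Dirichlet energy `∫ ‖Dζ‖² dμ < ε`. -/
theorem weighted_capacity_estimate
    (m : ℕ) (hm : 1 ≤ m)
    (μ : MeasureTheory.Measure (EuclideanSpace ℝ (Fin m)))
    (C a : ℝ) (hC : 0 < C) (ha : 0 < a)
    (hgrowth : ∀ (p : EuclideanSpace ℝ (Fin m)) (r : ℝ), 0 < r →
      μ (Metric.closedBall p r) ≤ ENNReal.ofReal (C * r ^ (a + 2)))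
    (S : Set (EuclideanSpace ℝ (Fin m))) (hS : IsCompact S)
    (hnull : μH[a] S = 0) :
    ∀ ε : ℝ, 0 < ε →
      ∃ ζ : EuclideanSpace ℝ (Fin m) → ℝ,
        ContDiff ℝ 1 ζ ∧
        (∀ x, 0 ≤ ζ x ∧ ζ x ≤ 1) ∧
        (∃ V : Set (EuclideanSpace ℝ (Fin m)), IsOpen V ∧ S ⊆ V ∧ ∀ x ∈ V, ζ x = 1) ∧
        tsupport ζ ⊆ {x | Metric.infDist x S < ε} ∧
        ∫ x, ‖fderiv ℝ ζ x‖ ^ 2 ∂μ < ε := by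
  intro ε hε
  have hK : 0 < 32 * C * 2 ^ (a + 2) := by positivity
  obtain ⟨F, p, r, hF, hSF, hsum⟩ := hS.exists_finset_ball_cover_sum_rpow_lt ha hnull
    (half_pos hε) (div_pos hε hK)
  have hr : ∀ i ∈ F, 0 < r i := fun i hi ↦ (hF i hi).2.1
  refine ⟨bumpCutoff F p r, contDiff_bumpCutoff,
    fun x ↦ ⟨bumpCutoff_nonneg x, bumpCutoff_le_one x⟩,
    ⟨⋃ i ∈ F, ball (p i) (r i), isOpen_biUnion fun _ _ ↦ isOpen_ball, hSF,
      fun x hx ↦ bumpCutoff_eq_one hr hx⟩, fun x hx ↦ ?_, ?_⟩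
  · have hx' := tsupport_bumpCutoff_subset hr hx
    simp only [mem_iUnion, mem_closedBall] at hx'
    obtain ⟨i, hi, hxi⟩ := hx'
    have hdist := infDist_le_dist_of_mem (x := x) (hF i hi).1
    have hrε := (hF i hi).2.2
    exact (show infDist x S < ε by linarith)
  · refine (integral_norm_fderiv_bumpCutoff_sq_le hC.le hgrowth hr).trans_lt ?_
    rwa [lt_div_iff₀' hK] at hsum
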